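/- Fix N ≥ 1 and an injective v : Fin N → ℂ. Then the set { u : Fin N → ℂ | for every k with 1 ≤ k ≤ N, ∑_i (u i)^k = ∑_i (v i)^k } is finite and has exactly N! elements. (The count of solutions of the bipartite system in Lemma B.2, in the case of distinct values v_i.) -/

import Mathlib

open Finset MvPolynomial in
/-- In characteristic zero, the first `n` power sums determine the first `n` elementary
symmetric functions. -/
theorem aeval_esymm_eq_of_sum_pow_eq {σ K : Type*} [Fintype σ] [Field K] [CharZero K]
    {n : ℕ} {u v : σ → K}
    (h : ∀ k : ℕ, 1 ≤ k → k ≤ n → ∑ i, u i ^ k = ∑ i, v i ^ k) {k : ℕ} (hk : k ≤ n) :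
    aeval u (esymm σ K k) = aeval v (esymm σ K k) := by
  induction k using Nat.strong_induction_on with
  | _ k ih =>
    obtain rfl | hk0 := Nat.eq_zero_or_pos k
    · simp
    have newton (w : σ → K) := congrArg (aeval w) (mul_esymm_eq_sum σ K k)
    simp only [map_mul, map_natCast, map_sum, map_pow, map_neg, map_one] at newton
    refine mul_left_cancel₀ (Nat.cast_ne_zero.mpr hk0.ne' : (k : K) ≠ 0) ?_
    rw [newton u, newton v]
    congr 1
    refine sum_congr rfl fun a ha ↦ ?_
    obtain ⟨hak, ha1⟩ := mem_filter.mp ha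
    rw [HasAntidiagonal.mem_antidiagonal] at hak
    rw [ih a.1 ha1 (by omega)]
    congr 1
    simpa [psum] using h a.2 (by omega) (by omega)

/-- In characteristic zero, a finite family is determined up to order by its first power sums. -/
theorem Multiset.map_univ_eq_of_sum_pow_eq {σ K : Type*} [Fintype σ] [Field K] [CharZero K]
    {u v : σ → K}
    (h : ∀ k : ℕ, 1 ≤ k → k ≤ Fintype.card σ → ∑ i, u i ^ k = ∑ i, v i ^ k) :
    Finset.univ.val.map u = Finset.univ.val.map v := by
  rw [← Polynomial.roots_multiset_prod_X_sub_C (Finset.univ.val.map u),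
    ← Polynomial.roots_multiset_prod_X_sub_C (Finset.univ.val.map v),
    Multiset.prod_X_sub_X_eq_sum_esymm, Multiset.prod_X_sub_X_eq_sum_esymm]
  simp only [Multiset.card_map, Finset.card_val, Finset.card_univ]
  congr 1
  refine Finset.sum_congr rfl fun k hk ↦ ?_
  rw [← MvPolynomial.aeval_esymm_eq_multiset_esymm σ K,
    ← MvPolynomial.aeval_esymm_eq_multiset_esymm σ K,
    aeval_esymm_eq_of_sum_pow_eq h (by simpa [Nat.lt_succ_iff] using hk)]

/-- A family with the same multiset of values as an injective family is a reindexing of it. -/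
theorem exists_perm_comp_eq_of_map_univ_eq {σ α : Type*} [Fintype σ] {u v : σ → α}
    (hv : Function.Injective v) (h : Finset.univ.val.map u = Finset.univ.val.map v) :
    ∃ s : Equiv.Perm σ, v ∘ s = u := by
  have hu : Function.Injective u := by
    rw [← Fintype.nodup_map_univ_iff_injective] at hv ⊢
    rwa [h]
  have hmem (i : σ) : ∃ j, v j = u i := by
    have : u i ∈ Finset.univ.val.map v := h ▸ Multiset.mem_map_of_mem u (Finset.mem_univ i)
    simpa using this
  choose s hs using hmem
  have hs_inj : Function.Injective s := fun i j hij ↦ hu (by rw [← hs, ← hs, hij])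
  exact ⟨Equiv.ofBijective s (Finite.injective_iff_bijective.mp hs_inj), funext hs⟩

/-- The solutions of the power-sum system are the reindexings of `v`. -/
theorem setOf_sum_pow_eq_eq_range_comp_perm {σ K : Type*} [Fintype σ] [Field K] [CharZero K]
    {v : σ → K} (hv : Function.Injective v) :
    {u : σ → K | ∀ k : ℕ, 1 ≤ k → k ≤ Fintype.card σ → ∑ i, u i ^ k = ∑ i, v i ^ k} =
      Set.range fun s : Equiv.Perm σ ↦ v ∘ s := by
  ext u
  constructor
  · exact fun h ↦ exists_perm_comp_eq_of_map_univ_eq hv (Multiset.map_univ_eq_of_sum_pow_eq h)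
  · rintro ⟨s, rfl⟩ k - -
    exact Equiv.sum_comp s fun i ↦ v i ^ k

/-- The count of solutions of the bipartite system in Lemma B.2: for injective `v`,
the solution set of the power-sum system has exactly `Nat.factorial N` elements. -/
theorem bipartite_system_card_solutions
    (N : ℕ) (hN : 1 ≤ N) (v : Fin N → ℂ) (hv : Function.Injective v) :
    ({ u : Fin N → ℂ | ∀ k : ℕ, 1 ≤ k → k ≤ N →
        ∑ i : Fin N, (u i) ^ k = ∑ i : Fin N, (v i) ^ k }).Finite ∧
      ({ u : Fin N → ℂ | ∀ k : ℕ, 1 ≤ k → k ≤ N →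
        ∑ i : Fin N, (u i) ^ k = ∑ i : Fin N, (v i) ^ k }).ncard = Nat.factorial N := by
  have hrange := setOf_sum_pow_eq_eq_range_comp_perm hv
  rw [Fintype.card_fin] at hrange
  have hinj : Function.Injective fun s : Equiv.Perm (Fin N) ↦ v ∘ s :=
    fun s t hst ↦ Equiv.ext fun i ↦ hv (congrFun hst i)
  rw [hrange]
  refine ⟨Set.finite_range _, ?_⟩
  rw [← Set.image_univ, Set.ncard_image_of_injective _ hinj, Set.ncard_univ, Nat.card_perm,
    Nat.card_fin]
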